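/- There exists a spline F on (G, m, r) such that the value F(v_1) generates the ideal K(v_1), i.e., F(v_1)·ℤ = K(v_1). -/

import Mathlib

/-- `g(W)`: the gcd of the edge labels traversed by a walk `W`
(equal to `0` for a walk with no edges). -/
def walkGcd {V : Type*} {G : SimpleGraph V} (r : V → V → ℤ) {u v : V}
    (W : G.Walk u v) : ℤ :=
  (W.darts.map (fun d => r d.toProd.1 d.toProd.2)).foldr gcd 0

/-- `I(u, v)`: the intersection of the ideals `g(W)ℤ` over all trails `W`
from `u` to `v` (equal to `ℤ` when there is no such trail). -/
def trailIdeal {V : Type*} (G : SimpleGraph V) (r : V → V → ℤ) (u v : V) :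
    Ideal ℤ :=
  ⨅ (W : G.Walk u v) (_ : W.IsTrail), Ideal.span {walkGcd r W}

/-- `K(v) = m(v)ℤ ∩ ⋂_{u ≠ v} (m(u)ℤ + I(u, v))`. -/
def vertexIdeal {V : Type*} (G : SimpleGraph V) (m : V → ℤ)
    (r : V → V → ℤ) (v : V) : Ideal ℤ :=
  Ideal.span {m v} ⊓ ⨅ (u : V) (_ : u ≠ v), (Ideal.span {m u} ⊔ trailIdeal G r u v)

theorem dvd_walkGcd_iff {V : Type*} {G : SimpleGraph V} (r : V → V → ℤ) {u v : V}
    (W : G.Walk u v) (q : ℤ) :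
    q ∣ walkGcd r W ↔ ∀ d ∈ W.darts, q ∣ r d.toProd.1 d.toProd.2 := by
  unfold walkGcd
  induction W.darts with
  | nil => simp
  | cons d l ih => simp [dvd_gcd_iff, ih]

theorem walkGcd_dvd_sub {V : Type*} {G : SimpleGraph V} {r : V → V → ℤ} {f : V → ℤ}
    (hf : ∀ u w, G.Adj u w → r u w ∣ f u - f w) {u v : V} (W : G.Walk u v) :
    walkGcd r W ∣ f u - f v := by
  induction W with
  | nil => simp
  | @cons a b c h W ih =>
    have hd := (dvd_walkGcd_iff r (W.cons h) _).1 dvd_rfl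
    have h₁ : walkGcd r (W.cons h) ∣ f a - f b :=
      (hd ⟨(a, b), h⟩ (by simp)).trans (hf a b h)
    have h₂ : walkGcd r (W.cons h) ∣ f b - f c :=
      ((dvd_walkGcd_iff r W _).2 fun d hdW => hd d (by simp [hdW])).trans ih
    simpa using dvd_add h₁ h₂

theorem mem_trailIdeal_iff {V : Type*} {G : SimpleGraph V} {r : V → V → ℤ} {u v : V} {x : ℤ} :
    x ∈ trailIdeal G r u v ↔ ∀ W : G.Walk u v, W.IsTrail → walkGcd r W ∣ x := by
  simp [trailIdeal, Ideal.mem_span_singleton]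

/-- The submodule of splines on `(G, m, r)`. -/
def splines {V : Type*} (G : SimpleGraph V) (m : V → ℤ) (r : V → V → ℤ) :
    Submodule ℤ (V → ℤ) where
  carrier := {f | (∀ v, m v ∣ f v) ∧ ∀ u w, G.Adj u w → r u w ∣ f u - f w}
  zero_mem' := by simp
  add_mem' := by
    rintro f g ⟨hf, hf'⟩ ⟨hg, hg'⟩
    refine ⟨fun v => dvd_add (hf v) (hg v), fun u w h => ?_⟩
    simpa [add_sub_add_comm] using dvd_add (hf' u w h) (hg' u w h)
  smul_mem' := by
    rintro c f ⟨hf, hf'⟩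
    refine ⟨fun v => dvd_mul_of_dvd_right (hf v) c, fun u w h => ?_⟩
    simpa [mul_sub] using dvd_mul_of_dvd_right (hf' u w h) c

theorem apply_mem_vertexIdeal {V : Type*} {G : SimpleGraph V} {m : V → ℤ} {r : V → V → ℤ}
    {f : V → ℤ} (hf : f ∈ splines G m r) (v : V) : f v ∈ vertexIdeal G m r v := by
  simp only [vertexIdeal, Submodule.mem_inf, Submodule.mem_iInf, Ideal.mem_span_singleton]
  refine ⟨hf.1 v, fun u _ => ?_⟩
  rw [← sub_sub_cancel (f u) (f v)]
  exact sub_mem (Ideal.mem_sup_left (Ideal.mem_span_singleton.2 (hf.1 u)))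
    (Ideal.mem_sup_right (mem_trailIdeal_iff.2 fun W _ => walkGcd_dvd_sub hf.2 W))

theorem prime_pow_dvd_or_dvd_of_dvd_lcm {p : ℕ} (hp : p.Prime) (k : ℕ) {a b : ℤ}
    (h : (p : ℤ) ^ k ∣ lcm a b) : (p : ℤ) ^ k ∣ a ∨ (p : ℤ) ^ k ∣ b := by
  rcases eq_or_ne a 0 with rfl | ha
  · simp
  rcases eq_or_ne b 0 with rfl | hb
  · simp
  have h' : p ^ k ∣ Nat.lcm a.natAbs b.natAbs := by
    rw [← Int.coe_lcm] at h
    exact_mod_cast h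
  have ha' := Int.natAbs_ne_zero.2 ha
  have hb' := Int.natAbs_ne_zero.2 hb
  rw [hp.pow_dvd_iff_le_factorization (Nat.lcm_ne_zero ha' hb'),
    Nat.factorization_lcm ha' hb', Finsupp.sup_apply, le_sup_iff,
    ← hp.pow_dvd_iff_le_factorization ha', ← hp.pow_dvd_iff_le_factorization hb'] at h'
  simpa [← Int.natCast_dvd_natCast] using h'

theorem exists_common_multiple_not_dvd {ι : Type*} {p : ℕ} (hp : p.Prime) (k : ℕ) (hk : k ≠ 0)
    (s : Finset ι) (a : ι → ℤ) (h : ∀ i ∈ s, ¬ (p : ℤ) ^ k ∣ a i) :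
    ∃ y : ℤ, ¬ (p : ℤ) ^ k ∣ y ∧ ∀ i ∈ s, a i ∣ y := by
  classical
  refine ⟨s.lcm a, ?_, fun i hi => Finset.dvd_lcm hi⟩
  induction s using Finset.induction_on with
  | empty =>
    rw [Finset.lcm_empty]
    exact fun h1 => (Nat.prime_iff_prime_int.1 hp).not_dvd_one ((dvd_pow_self _ hk).trans h1)
  | insert i s _ ih =>
    rw [Finset.lcm_insert]
    intro hd
    rcases prime_pow_dvd_or_dvd_of_dvd_lcm hp k hd with hi | hs
    · exact h i (by simp) hi
    · exact ih (fun j hj => h j (by simp [hj])) hs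

/-- If a prime power does not divide some element of `vertexIdeal G m r v`, then it does not divide
the value at `v` of some spline: take a suitable constant on the set of vertices joined to `v` by
a walk all of whose labels are divisible by the prime power, and zero elsewhere. -/
theorem exists_spline_apply_not_dvd {V : Type*} [Finite V] {G : SimpleGraph V} {m : V → ℤ}
    {r : V → V → ℤ} (hr : ∀ u w, r u w = r w u) {v : V} {x : ℤ} (hx : x ∈ vertexIdeal G m r v)
    {p k : ℕ} (hp : p.Prime) (hpx : ¬ (p : ℤ) ^ k ∣ x) :
    ∃ f ∈ splines G m r, ¬ (p : ℤ) ^ k ∣ f v := by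
  classical
  have := Fintype.ofFinite V
  simp only [vertexIdeal, Submodule.mem_inf, Submodule.mem_iInf, Ideal.mem_span_singleton] at hx
  have hk : k ≠ 0 := by
    rintro rfl
    simp at hpx
  let A : Set V := {u | ∃ W : G.Walk u v, (p : ℤ) ^ k ∣ walkGcd r W}
  have hvA : v ∈ A := ⟨.nil, by simp [dvd_walkGcd_iff]⟩
  have hm : ∀ u ∈ A, ¬ (p : ℤ) ^ k ∣ m u := by
    rintro u ⟨W, hW⟩ hu
    apply hpx
    rcases eq_or_ne u v with rfl | huv
    · exact hu.trans hx.1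
    obtain ⟨a, ha, b, hb, rfl⟩ := Submodule.mem_sup.1 (hx.2 u huv)
    refine dvd_add (hu.trans (Ideal.mem_span_singleton.1 ha)) ?_
    refine dvd_trans ?_ (mem_trailIdeal_iff.1 hb W.bypass W.bypass_isPath.isTrail)
    rw [dvd_walkGcd_iff] at hW ⊢
    exact fun d hd => hW d (W.darts_bypass_subset_darts hd)
  have hbd : ∀ u w, G.Adj u w → u ∈ A → w ∉ A → ¬ (p : ℤ) ^ k ∣ r u w := by
    rintro u w h ⟨W, hW⟩ hw hq
    refine hw ⟨W.cons h.symm, ?_⟩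
    rw [dvd_walkGcd_iff] at hW ⊢
    simpa [hr w u, hq] using hW
  obtain ⟨y₁, hy₁, hmy⟩ := exists_common_multiple_not_dvd hp k hk
    (Finset.univ.filter (· ∈ A)) m (by simpa using hm)
  obtain ⟨y₂, hy₂, hry⟩ := exists_common_multiple_not_dvd hp k hk
    (Finset.univ.filter fun e : V × V => G.Adj e.1 e.2 ∧ e.1 ∈ A ∧ e.2 ∉ A)
    (fun e => r e.1 e.2) (by
      intro e he
      obtain ⟨h, h₁, h₂⟩ := (Finset.mem_filter.1 he).2
      exact hbd _ _ h h₁ h₂)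
  have hry' : ∀ u w, G.Adj u w → u ∈ A → w ∉ A → r u w ∣ lcm y₁ y₂ := fun u w h hu hw =>
    (hry (u, w) (Finset.mem_filter.2 ⟨Finset.mem_univ _, h, hu, hw⟩)).trans (dvd_lcm_right _ _)
  refine ⟨fun u => if u ∈ A then lcm y₁ y₂ else 0, ⟨fun u => ?_, fun u w h => ?_⟩, ?_⟩
  · dsimp only
    split_ifs with hu
    · exact (hmy u (by simpa using hu)).trans (dvd_lcm_left _ _)
    · exact dvd_zero _
  · dsimp only
    split_ifs with hu hw hw
    · simp
    · simpa using hry' u w h hu hw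
    · rw [hr, zero_sub, dvd_neg]
      exact hry' w u h.symm hw hu
    · simp
  · dsimp only
    rw [if_pos hvA]
    exact fun hd => (prime_pow_dvd_or_dvd_of_dvd_lcm hp k hd).elim hy₁ hy₂

theorem map_proj_splines_eq_vertexIdeal {V : Type*} [Finite V] (G : SimpleGraph V) (m : V → ℤ)
    (r : V → V → ℤ) (hr : ∀ u w, r u w = r w u) (v : V) :
    (splines G m r).map (LinearMap.proj v) = vertexIdeal G m r v := by
  apply le_antisymm
  · rintro _ ⟨f, hf, rfl⟩
    exact apply_mem_vertexIdeal hf v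
  · intro x hx
    obtain ⟨s, hs⟩ := (IsPrincipalIdealRing.principal ((splines G m r).map (LinearMap.proj v))).1
    rw [hs]
    refine Ideal.mem_span_singleton.2 (Int.natAbs_dvd_natAbs.1 ?_)
    rw [Nat.dvd_iff_prime_pow_dvd_dvd]
    intro p k hp hps
    rw [← Int.natCast_dvd, Nat.cast_pow] at hps ⊢
    by_contra hpx
    obtain ⟨f, hf, hfv⟩ := exists_spline_apply_not_dvd hr hx hp hpx
    have hmem : f v ∈ Submodule.span ℤ {s} := hs ▸ Submodule.mem_map_of_mem hf
    exact hfv (hps.trans (Ideal.mem_span_singleton.1 hmem))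

/-- there is a spline `F` on `(G, m, r)` whose value at `v₁`
generates the ideal `K(v₁)`. -/
theorem exists_spline_generating_vertexIdeal {n : ℕ} (hn : 0 < n)
    (G : SimpleGraph (Fin n))
    (m : Fin n → ℤ) (r : Fin n → Fin n → ℤ) (hr : ∀ u w, r u w = r w u) :
    ∃ F : Fin n → ℤ,
      ((∀ v, m v ∣ F v) ∧ ∀ u w, G.Adj u w → r u w ∣ F u - F w) ∧
      Ideal.span {F ⟨0, hn⟩} = vertexIdeal G m r ⟨0, hn⟩ := by
  obtain ⟨s, hs⟩ := (IsPrincipalIdealRing.principal (vertexIdeal G m r ⟨0, hn⟩)).1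
  have hmem : s ∈ (splines G m r).map (LinearMap.proj ⟨0, hn⟩) := by
    rw [map_proj_splines_eq_vertexIdeal G m r hr, hs]
    exact Submodule.mem_span_singleton_self s
  obtain ⟨F, hF, rfl⟩ := hmem
  exact ⟨F, hF, hs.symm⟩
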